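/- arXiv:2307.01813 — 2 statements merged into one kernel-verified Lean document; each statement's English description precedes it below -/
import Mathlib

section
/- Let H be a directed graph on Fin n with nonnegative weights w and connected symmetrization, and let L^θ be its magnetic Laplacian with parameter θ ∈ ℝ. Then 0 is an eigenvalue of L^θ (equivalently, of the normalized magnetic Laplacian L^θ_rw = I − D⁻¹·W^θ) if and only if for every closed walk v_0, v_1, …, v_z = v_0 in the symmetrized graph, θ·(Σ_{k<z} a(v_k, v_{k+1})) is an integer multiple of 2π, where Σ_{k<z} a(v_k, v_{k+1}) is the signed effective length of the closed walk (equivalently, if and only if the complex-weighted graph with Hermitian weight matrix W^θ is structurally balanced). -/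
open Matrix Complex Finset

/-- The direction indicator `a(i,j)` of a directed graph with weights `w`. -/
noncomputable def dirSign {n : ℕ} (w : Fin n → Fin n → ℝ) (i j : Fin n) : ℝ :=
  if 0 < w i j ∧ w j i = 0 then 1
  else if w i j = 0 ∧ 0 < w j i then -1
  else 0

/-- The symmetrised weight `w_s(i,j) = (w i j + w j i)/2`. -/
noncomputable def symWeight {n : ℕ} (w : Fin n → Fin n → ℝ) (i j : Fin n) : ℝ :=
  (w i j + w j i) / 2

/-- The magnetic weight matrix `W^θ i j = w_s(i,j)·exp(𝕚·θ·a(i,j))`. -/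
noncomputable def magW {n : ℕ} (w : Fin n → Fin n → ℝ) (θ : ℝ) :
    Matrix (Fin n) (Fin n) ℂ :=
  fun i j => ((symWeight w i j : ℝ) : ℂ) *
    Complex.exp (Complex.I * ((θ * dirSign w i j : ℝ) : ℂ))

/-- The magnetic Laplacian `L^θ = D − W^θ`. -/
noncomputable def magLaplacian {n : ℕ} (w : Fin n → Fin n → ℝ) (θ : ℝ) :
    Matrix (Fin n) (Fin n) ℂ :=
  Matrix.diagonal (fun i => ((∑ j : Fin n, symWeight w i j : ℝ) : ℂ)) - magW w θ

/-- A walk in the symmetrised graph. -/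
def IsSymWalk {n : ℕ} (w : Fin n → Fin n → ℝ) (z : ℕ) (v : ℕ → Fin n) : Prop :=
  ∀ k < z, 0 < symWeight w (v k) (v (k + 1))

/-- There is a walk from `i` to `j` of signed effective length `s`. -/
def SymReach {n : ℕ} (w : Fin n → Fin n → ℝ) (i j : Fin n) (s : ℝ) : Prop :=
  ∃ (z : ℕ) (v : ℕ → Fin n), IsSymWalk w z v ∧ v 0 = i ∧ v z = j ∧
    ∑ k ∈ Finset.range z, dirSign w (v k) (v (k + 1)) = s

lemma SymReach.trans {n : ℕ} {w : Fin n → Fin n → ℝ} {i j k : Fin n} {s t : ℝ}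
    (h1 : SymReach w i j s) (h2 : SymReach w j k t) : SymReach w i k (s + t) := by
  obtain ⟨z, v, hv, h0, hz, hs⟩ := h1
  obtain ⟨z', v', hv', h0', hz', hs'⟩ := h2
  have e1 : ∀ l, l ≤ z → (fun l => if l ≤ z then v l else v' (l - z)) l = v l := by
    intro l hl
    simp [hl]
  have e2 : ∀ l, (fun l => if l ≤ z then v l else v' (l - z)) (z + l) = v' l := by
    intro l
    rcases Nat.eq_zero_or_pos l with rfl | hl
    · simp [hz, h0']
    · have : ¬ (z + l ≤ z) := by omega
      simp only [this, if_false]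
      congr 1
      omega
  generalize (fun l => if l ≤ z then v l else v' (l - z)) = u at e1 e2
  refine ⟨z + z', u, ?_, ?_, ?_, ?_⟩
  · intro l hl
    by_cases h : l < z
    · rw [e1 l h.le, e1 (l + 1) h]
      exact hv l h
    · obtain ⟨m, rfl⟩ := Nat.exists_eq_add_of_le (not_lt.mp h)
      rw [add_assoc, e2, e2]
      exact hv' m (by omega)
  · rw [e1 0 (Nat.zero_le _), h0]
  · rw [e2, hz']
  · rw [Finset.sum_range_add, ← hs, ← hs']
    congr 1
    · refine Finset.sum_congr rfl fun l hl => ?_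
      have h := Finset.mem_range.mp hl
      rw [e1 l h.le, e1 (l + 1) h]
    · refine Finset.sum_congr rfl fun l hl => ?_
      rw [add_assoc, e2, e2]

lemma SymReach.edge {n : ℕ} {w : Fin n → Fin n → ℝ} {i j : Fin n}
    (h : 0 < symWeight w i j) : SymReach w i j (dirSign w i j) := by
  refine ⟨1, fun k => if k = 0 then i else j, ?_, by simp, by simp, by simp⟩
  intro k hk
  obtain rfl : k = 0 := by omega
  simpa using h

lemma mag_mulVec_apply {n : ℕ} (w : Fin n → Fin n → ℝ) (θ : ℝ) (v : Fin n → ℂ) (i : Fin n) :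
    (magLaplacian w θ).mulVec v i = ∑ j, ((symWeight w i j : ℝ) : ℂ) *
      (v i - Complex.exp (Complex.I * ((θ * dirSign w i j : ℝ) : ℂ)) * v j) := by
  rw [magLaplacian, Matrix.sub_mulVec, Pi.sub_apply, Matrix.mulVec_diagonal]
  simp only [Matrix.mulVec, dotProduct, magW]
  push_cast
  rw [Finset.sum_mul, ← Finset.sum_sub_distrib]
  refine Finset.sum_congr rfl fun j _ => ?_
  ring

lemma normSq_sub_unit (a b e : ℂ) (he : Complex.normSq e = 1) :
    Complex.normSq (a - e * b) =
      2 * ((starRingEnd ℂ) a * (a - e * b)).re + (Complex.normSq b - Complex.normSq a) := by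
  have h : Complex.normSq (e * b) = Complex.normSq b := by rw [map_mul, he, one_mul]
  rw [← h]
  generalize e * b = c
  simp only [Complex.normSq_apply, Complex.mul_re, Complex.sub_re, Complex.sub_im,
    Complex.conj_re, Complex.conj_im]
  ring

lemma edge_eq {n : ℕ} (w : Fin n → Fin n → ℝ) (hw : ∀ i j, 0 ≤ w i j) (θ : ℝ) (v : Fin n → ℂ)
    (hv : (magLaplacian w θ).mulVec v = 0) (i j : Fin n) (hij : 0 < symWeight w i j) :
    v i = Complex.exp (Complex.I * ((θ * dirSign w i j : ℝ) : ℂ)) * v j := by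
  have hnn : ∀ i j, 0 ≤ symWeight w i j := fun i j => by
    have := hw i j
    have := hw j i
    unfold symWeight
    positivity
  have hsymm : ∀ i j, symWeight w i j = symWeight w j i := fun i j => by
    unfold symWeight
    ring
  set E : Fin n → Fin n → ℂ := fun i j =>
    Complex.exp (Complex.I * ((θ * dirSign w i j : ℝ) : ℂ)) with hE
  have hEn : ∀ i j, Complex.normSq (E i j) = 1 := fun i j => by
    rw [Complex.normSq_eq_norm_sq, hE]
    simp only [mul_comm Complex.I, Complex.norm_exp_ofReal_mul_I]
    norm_num
  have hrow : ∀ i, ∑ j, symWeight w i j * ((starRingEnd ℂ) (v i) * (v i - E i j * v j)).re = 0 := by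
    intro i
    have h1 : (starRingEnd ℂ) (v i) * (magLaplacian w θ).mulVec v i = 0 := by
      rw [hv]
      simp
    rw [mag_mulVec_apply, Finset.mul_sum] at h1
    have h2 := congrArg Complex.re h1
    rw [Complex.re_sum, Complex.zero_re] at h2
    rw [← h2]
    refine Finset.sum_congr rfl fun j _ => ?_
    rw [mul_left_comm, Complex.re_ofReal_mul]
  have htot : ∑ i, ∑ j, symWeight w i j * Complex.normSq (v i - E i j * v j) = 0 := by
    have h1 : ∑ i, ∑ j, symWeight w i j * Complex.normSq (v j)
        = ∑ i, ∑ j, symWeight w i j * Complex.normSq (v i) := by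
      rw [Finset.sum_comm]
      refine Finset.sum_congr rfl fun a _ => Finset.sum_congr rfl fun b _ => ?_
      rw [hsymm]
    have h2 : ∀ i j, symWeight w i j * Complex.normSq (v i - E i j * v j) =
        2 * (symWeight w i j * ((starRingEnd ℂ) (v i) * (v i - E i j * v j)).re) +
        (symWeight w i j * Complex.normSq (v j) - symWeight w i j * Complex.normSq (v i)) := by
      intro i j
      rw [normSq_sub_unit _ _ _ (hEn i j)]
      ring
    simp only [h2, Finset.sum_add_distrib, Finset.sum_sub_distrib, ← Finset.mul_sum, hrow]
    simp only [Finset.mul_sum, h1]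
    simp
  have hpos : ∀ i j, 0 ≤ symWeight w i j * Complex.normSq (v i - E i j * v j) :=
    fun i j => mul_nonneg (hnn i j) (Complex.normSq_nonneg _)
  have h3 := (Finset.sum_eq_zero_iff_of_nonneg
    (fun i _ => Finset.sum_nonneg fun j _ => hpos i j)).mp htot i (Finset.mem_univ i)
  have h4 := (Finset.sum_eq_zero_iff_of_nonneg (fun j _ => hpos i j)).mp h3 j (Finset.mem_univ j)
  have h5 := (mul_eq_zero.mp h4).resolve_left hij.ne'
  exact sub_eq_zero.mp (Complex.normSq_eq_zero.mp h5)

lemma walk_eq {n : ℕ} (w : Fin n → Fin n → ℝ) (θ : ℝ) (x : Fin n → ℂ)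
    (hx : ∀ i j, 0 < symWeight w i j →
      x i = Complex.exp (Complex.I * ((θ * dirSign w i j : ℝ) : ℂ)) * x j)
    (v : ℕ → Fin n) (z : ℕ) (hv : IsSymWalk w z v) :
    x (v 0) = Complex.exp (Complex.I *
      ((θ * ∑ k ∈ Finset.range z, dirSign w (v k) (v (k + 1)) : ℝ) : ℂ)) * x (v z) := by
  induction z with
  | zero => simp
  | succ z ih =>
    rw [ih (fun k hk => hv k (by omega)), hx _ _ (hv z (by omega)), ← mul_assoc,
      ← Complex.exp_add, Finset.sum_range_succ]
    congr 2
    push_cast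
    ring

theorem magLaplacian_zero_eigenvalue_iff {n : ℕ} (hn : 2 ≤ n)
    (w : Fin n → Fin n → ℝ) (hw : ∀ i j, 0 ≤ w i j) (hdiag : ∀ i, w i i = 0)
    (hconn : ∀ i j : Fin n, i ≠ j →
      ∃ (z : ℕ) (v : ℕ → Fin n), IsSymWalk w z v ∧ v 0 = i ∧ v z = j)
    (θ : ℝ) :
    (∃ v : Fin n → ℂ, v ≠ 0 ∧ (magLaplacian w θ).mulVec v = 0) ↔
      ∀ (z : ℕ) (v : ℕ → Fin n), IsSymWalk w z v → v z = v 0 →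
        ∃ m : ℤ, θ * (∑ k ∈ Finset.range z, dirSign w (v k) (v (k + 1)))
          = 2 * Real.pi * m := by
  constructor
  · rintro ⟨x, hx0, hx⟩ z v hv hz
    have he := edge_eq w hw θ x hx
    obtain ⟨i, hi⟩ := Function.ne_iff.mp hx0
    have hne : ∀ j, x j ≠ 0 := by
      intro j hj
      by_cases hij : i = j
      · subst hij
        exact hi hj
      · obtain ⟨z', v', hv', h0, h1⟩ := hconn i j hij
        have := walk_eq w θ x he v' z' hv'
        rw [h0, h1, hj, mul_zero] at this
        exact hi this
    have h := walk_eq w θ x he v z hv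
    rw [hz] at h
    have h1 := (mul_eq_right₀ (hne (v 0))).mp h.symm
    obtain ⟨m, hm⟩ := Complex.exp_eq_one_iff.mp h1
    refine ⟨m, ?_⟩
    have h2 : Complex.I * ((θ * ∑ k ∈ Finset.range z, dirSign w (v k) (v (k + 1)) : ℝ) : ℂ)
        = Complex.I * ((2 * Real.pi * m : ℝ) : ℂ) := by
      rw [hm]
      push_cast
      ring
    exact Complex.ofReal_injective (mul_left_cancel₀ Complex.I_ne_zero h2)
  · intro H
    have hreach : ∀ i j : Fin n, ∃ s, SymReach w i j s := by
      intro i j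
      by_cases hij : i = j
      · exact ⟨_, 0, fun _ => i, fun k hk => absurd hk (by omega), rfl, hij, rfl⟩
      · obtain ⟨z, v, hv, h0, h1⟩ := hconn i j hij
        exact ⟨_, z, v, hv, h0, h1, rfl⟩
    have hcl : ∀ i s, SymReach w i i s →
        Complex.exp (Complex.I * ((θ * s : ℝ) : ℂ)) = 1 := by
      rintro i s ⟨z, v, hv, h0, h1, rfl⟩
      obtain ⟨m, hm⟩ := H z v hv (h1.trans h0.symm)
      rw [hm, Complex.exp_eq_one_iff]
      refine ⟨m, ?_⟩
      push_cast
      ring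
    let r : Fin n := ⟨0, by omega⟩
    choose S hS using fun j => hreach j r
    choose T hT using fun j => hreach r j
    refine ⟨fun j => Complex.exp (Complex.I * ((θ * S j : ℝ) : ℂ)), ?_, ?_⟩
    · intro h
      exact Complex.exp_ne_zero _ (congrFun h r)
    · funext i
      rw [mag_mulVec_apply]
      refine Finset.sum_eq_zero fun j _ => ?_
      have hnn : 0 ≤ symWeight w i j := by
        have := hw i j
        have := hw j i
        unfold symWeight
        positivity
      rcases hnn.eq_or_lt with h | h
      · rw [← h]
        simp
      · have h1 := hcl r _ ((hT i).trans (hS i))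
        have h2 := hcl r _ ((hT i).trans ((SymReach.edge h).trans (hS j)))
        have h3 := h1.trans h2.symm
        simp only [mul_add, Complex.ofReal_add, Complex.exp_add] at h3
        have h4 := mul_left_cancel₀ (Complex.exp_ne_zero _) h3
        rw [sub_eq_zero.mpr h4, mul_zero]
end

section
/- Let H be a directed graph on Fin n with nonnegative weights w and connected symmetrization, and let L^θ_rw = I − D⁻¹·W^θ be its normalized magnetic Laplacian with parameter θ ∈ ℝ. Then 2 is an eigenvalue of L^θ_rw if and only if for every closed walk v_0, v_1, …, v_z = v_0 in the symmetrized graph, θ·(Σ_{k<z} a(v_k, v_{k+1})) + π·z is an integer multiple of 2π (equivalently, if and only if the complex-weighted graph with Hermitian weight matrix W^θ is structurally antibalanced). -/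
open Matrix Complex Finset

/-- The normalised magnetic Laplacian `L^θ_rw = I − D⁻¹·W^θ`. -/
noncomputable def magLaplacianRW {n : ℕ} (w : Fin n → Fin n → ℝ) (θ : ℝ) :
    Matrix (Fin n) (Fin n) ℂ :=
  1 - (Matrix.diagonal (fun i => ((∑ j : Fin n, symWeight w i j : ℝ) : ℂ)))⁻¹ * magW w θ

/-- The phase `exp(𝕚·θ·a(i,j))` of an edge. -/
noncomputable def edgePhase {n : ℕ} (w : Fin n → Fin n → ℝ) (θ : ℝ) (i j : Fin n) : ℂ :=
  Complex.exp (Complex.I * ((θ * dirSign w i j : ℝ) : ℂ))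

/-- Walks recorded together with the product of the negated phases along them. -/
inductive PhaseReach {n : ℕ} (w : Fin n → Fin n → ℝ) (θ : ℝ) : Fin n → Fin n → ℂ → Prop
  | refl (i : Fin n) : PhaseReach w θ i i 1
  | cons (i k j : Fin n) (c : ℂ) (h : 0 < symWeight w i k) (t : PhaseReach w θ k j c) :
      PhaseReach w θ i j (-edgePhase w θ i k * c)

lemma symWeight_comm {n : ℕ} (w : Fin n → Fin n → ℝ) (i j : Fin n) :
    symWeight w i j = symWeight w j i := by
  unfold symWeight; ring

lemma dirSign_anti {n : ℕ} (w : Fin n → Fin n → ℝ) (i j : Fin n) :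
    dirSign w j i = - dirSign w i j := by
  unfold dirSign
  split_ifs <;> grind

lemma edgePhase_mul {n : ℕ} (w : Fin n → Fin n → ℝ) (θ : ℝ) (i j : Fin n) :
    edgePhase w θ i j * edgePhase w θ j i = 1 := by
  unfold edgePhase
  rw [← Complex.exp_add, dirSign_anti w i j]
  push_cast
  ring_nf
  simp

lemma edgePhase_norm {n : ℕ} (w : Fin n → Fin n → ℝ) (θ : ℝ) (i j : Fin n) :
    ‖edgePhase w θ i j‖ = 1 := by
  unfold edgePhase
  rw [mul_comm]
  exact Complex.norm_exp_ofReal_mul_I _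

lemma PhaseReach.trans {n : ℕ} {w : Fin n → Fin n → ℝ} {θ : ℝ} {i j k : Fin n} {c d : ℂ}
    (h : PhaseReach w θ i j c) (h2 : PhaseReach w θ j k d) : PhaseReach w θ i k (c * d) := by
  induction h with
  | refl i => simpa using h2
  | cons i l j c hl t ih =>
    have := PhaseReach.cons i l k _ hl (ih h2)
    rwa [← mul_assoc] at this

lemma PhaseReach.symm {n : ℕ} {w : Fin n → Fin n → ℝ} {θ : ℝ} {i j : Fin n} {c : ℂ}
    (h : PhaseReach w θ i j c) : ∃ d, c * d = 1 ∧ PhaseReach w θ j i d := by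
  induction h with
  | refl i => exact ⟨1, by simp, PhaseReach.refl i⟩
  | cons i l j c hl t ih =>
    obtain ⟨d, hd, hr⟩ := ih
    refine ⟨_, ?_, hr.trans (PhaseReach.cons l i i 1 (by rwa [symWeight_comm]) (PhaseReach.refl i))⟩
    have := edgePhase_mul w θ i l
    linear_combination (edgePhase w θ i l * edgePhase w θ l i) * hd + this

/-- The total phase of a walk. -/
noncomputable def walkPhase {n : ℕ} (w : Fin n → Fin n → ℝ) (θ : ℝ) (z : ℕ) (v : ℕ → Fin n) : ℂ :=
  Complex.exp (((θ * (∑ k ∈ Finset.range z, dirSign w (v k) (v (k + 1))) + Real.pi * z : ℝ) : ℂ)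
    * Complex.I)

lemma walkPhase_succ {n : ℕ} (w : Fin n → Fin n → ℝ) (θ : ℝ) (z : ℕ) (v : ℕ → Fin n) :
    walkPhase w θ (z + 1) v =
      -edgePhase w θ (v 0) (v 1) * walkPhase w θ z (fun k => v (k + 1)) := by
  unfold walkPhase edgePhase
  rw [Finset.sum_range_succ']
  have : ∀ x : ℂ, -x = Complex.exp (Real.pi * Complex.I) * x := by
    intro x; rw [Complex.exp_pi_mul_I]; ring
  rw [neg_mul, this, ← Complex.exp_add, ← Complex.exp_add]
  congr 1
  push_cast
  ring

lemma PhaseReach.of_walk {n : ℕ} (w : Fin n → Fin n → ℝ) (θ : ℝ) (z : ℕ) :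
    ∀ v : ℕ → Fin n, IsSymWalk w z v → PhaseReach w θ (v 0) (v z) (walkPhase w θ z v) := by
  induction z with
  | zero =>
    intro v _
    have : walkPhase w θ 0 v = 1 := by simp [walkPhase]
    rw [this]
    exact PhaseReach.refl _
  | succ z ih =>
    intro v hv
    rw [walkPhase_succ]
    exact PhaseReach.cons _ _ _ _ (hv 0 (Nat.succ_pos z))
      (ih (fun k => v (k + 1)) (fun k hk => hv (k + 1) (by omega)))

lemma PhaseReach.to_walk {n : ℕ} {w : Fin n → Fin n → ℝ} {θ : ℝ} {i j : Fin n} {c : ℂ}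
    (h : PhaseReach w θ i j c) :
    ∃ (z : ℕ) (v : ℕ → Fin n), IsSymWalk w z v ∧ v 0 = i ∧ v z = j ∧ walkPhase w θ z v = c := by
  induction h with
  | refl i => exact ⟨0, fun _ => i, fun k hk => by omega, rfl, rfl, by simp [walkPhase]⟩
  | cons i l j c hl t ih =>
    obtain ⟨z, v, hv, h0, hz, hc⟩ := ih
    refine ⟨z + 1, fun k => Nat.casesOn k i v, ?_, rfl, hz, ?_⟩
    · intro k hk
      cases k with
      | zero => simpa [h0] using hl
      | succ k => exact hv k (by omega)
    · rw [walkPhase_succ]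
      simp [h0, hc]

lemma walkPhase_eq_one {n : ℕ} (w : Fin n → Fin n → ℝ) (θ : ℝ) (z : ℕ) (v : ℕ → Fin n) :
    walkPhase w θ z v = 1 ↔
      ∃ m : ℤ, θ * (∑ k ∈ Finset.range z, dirSign w (v k) (v (k + 1))) + Real.pi * z
          = 2 * Real.pi * m := by
  unfold walkPhase
  rw [Complex.exp_eq_one_iff]
  refine exists_congr fun m => ?_
  rw [← mul_assoc, mul_left_inj' Complex.I_ne_zero, mul_comm (m : ℂ)]
  exact_mod_cast Iff.rfl

lemma eigen_iff {n : ℕ} (w : Fin n → Fin n → ℝ) (θ : ℝ)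
    (hd : ∀ i, (∑ j, symWeight w i j) ≠ 0) (x : Fin n → ℂ) :
    (magLaplacianRW w θ).mulVec x = (2 : ℂ) • x ↔
      ∀ i, ∑ j, (symWeight w i j : ℂ) * (x i + edgePhase w θ i j * x j) = 0 := by
  have hd' : ∀ i, ((∑ j, symWeight w i j : ℝ) : ℂ) ≠ 0 := fun i => by exact_mod_cast hd i
  have hinv : (Matrix.diagonal (fun i => ((∑ j : Fin n, symWeight w i j : ℝ) : ℂ)))⁻¹
      = Matrix.diagonal (fun i => ((∑ j : Fin n, symWeight w i j : ℝ) : ℂ)⁻¹) := by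
    apply Matrix.inv_eq_right_inv
    rw [Matrix.diagonal_mul_diagonal, ← Matrix.diagonal_one]
    congr 1
    funext i
    exact mul_inv_cancel₀ (hd' i)
  unfold magLaplacianRW
  rw [hinv, Matrix.sub_mulVec, Matrix.one_mulVec, ← Matrix.mulVec_mulVec, funext_iff]
  refine forall_congr' fun i => ?_
  have hs : ∑ j, (symWeight w i j : ℂ) * (x i + edgePhase w θ i j * x j)
      = ((∑ j, symWeight w i j : ℝ) : ℂ) * x i + (magW w θ).mulVec x i := by
    simp only [mul_add, Finset.sum_add_distrib, Matrix.mulVec, dotProduct, magW, edgePhase]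
    push_cast
    rw [Finset.sum_mul]
    simp only [mul_assoc]
  rw [hs, Pi.sub_apply, Matrix.mulVec_diagonal, Pi.smul_apply, smul_eq_mul]
  have := hd' i
  set d := ((∑ j, symWeight w i j : ℝ) : ℂ)
  constructor
  · intro h
    have h2 : d * (x i - d⁻¹ * (magW w θ).mulVec x i) = d * (2 * x i) := by rw [h]
    rw [mul_sub, mul_inv_cancel_left₀ this] at h2
    linear_combination -h2
  · intro h
    apply mul_left_cancel₀ this
    rw [mul_sub, mul_inv_cancel_left₀ this]
    linear_combination -h

lemma eq_neg_of_max {n : ℕ} (s : Fin n → ℝ) (hs : ∀ j, 0 ≤ s j) (a : ℂ) (y : Fin n → ℂ)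
    (hy : ∀ j, ‖y j‖ ≤ ‖a‖) (h : ∑ j, (s j : ℂ) * (a + y j) = 0) (j : Fin n) (hj : 0 < s j) :
    a = - y j := by
  have key : ∀ b : ℂ, ‖b‖ ≤ ‖a‖ →
      Complex.normSq (a + b) ≤ 2 * ((starRingEnd ℂ a) * (a + b)).re := by
    intro b hb
    have h1 : Complex.normSq b ≤ Complex.normSq a := by
      rw [Complex.normSq_eq_norm_sq, Complex.normSq_eq_norm_sq]
      gcongr
    simp only [Complex.normSq_apply, Complex.mul_re, Complex.conj_re, Complex.conj_im,
      Complex.add_re, Complex.add_im] at h1 ⊢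
    nlinarith
  have h2 : ∑ j, s j * ((starRingEnd ℂ a) * (a + y j)).re = 0 := by
    have := congrArg (fun t => ((starRingEnd ℂ a) * t).re) h
    simp only [Finset.mul_sum, Complex.re_sum, mul_zero, Complex.zero_re] at this
    rw [← this]
    refine Finset.sum_congr rfl fun k _ => ?_
    rw [mul_left_comm, Complex.re_ofReal_mul]
  have hnn : ∀ k, 0 ≤ ((starRingEnd ℂ a) * (a + y k)).re := fun k => by
    have := key (y k) (hy k)
    have := Complex.normSq_nonneg (a + y k)
    linarith
  rw [Finset.sum_eq_zero_iff_of_nonneg (fun k _ => mul_nonneg (hs k) (hnn k))] at h2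
  have h3 := h2 j (Finset.mem_univ j)
  have h4 : ((starRingEnd ℂ a) * (a + y j)).re = 0 := by
    rcases mul_eq_zero.1 h3 with h | h
    · exact absurd h hj.ne'
    · exact h
  have h5 := key (y j) (hy j)
  have h6 : Complex.normSq (a + y j) = 0 := le_antisymm (by linarith) (Complex.normSq_nonneg _)
  exact eq_neg_of_add_eq_zero_left (Complex.normSq_eq_zero.1 h6)

theorem magLaplacianRW_two_eigenvalue_iff {n : ℕ} (hn : 2 ≤ n)
    (w : Fin n → Fin n → ℝ) (hw : ∀ i j, 0 ≤ w i j) (hdiag : ∀ i, w i i = 0)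
    (hconn : ∀ i j : Fin n, i ≠ j →
      ∃ (z : ℕ) (v : ℕ → Fin n), IsSymWalk w z v ∧ v 0 = i ∧ v z = j)
    (θ : ℝ) :
    (∃ v : Fin n → ℂ, v ≠ 0 ∧ (magLaplacianRW w θ).mulVec v = (2 : ℂ) • v) ↔
      ∀ (z : ℕ) (v : ℕ → Fin n), IsSymWalk w z v → v z = v 0 →
        ∃ m : ℤ, θ * (∑ k ∈ Finset.range z, dirSign w (v k) (v (k + 1))) + Real.pi * z
          = 2 * Real.pi * m := by
  have hs : ∀ i j, 0 ≤ symWeight w i j := fun i j => by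
    have := hw i j
    have := hw j i
    unfold symWeight; linarith
  have hd : ∀ i, (∑ j, symWeight w i j) ≠ 0 := by
    intro i
    have : Nontrivial (Fin n) := Fin.nontrivial_iff_two_le.2 hn
    obtain ⟨j, hj⟩ := exists_ne i
    obtain ⟨z, v, hv, h0, hz⟩ := hconn i j hj.symm
    have hzpos : 0 < z := by
      rcases Nat.eq_zero_or_pos z with h | h
      · subst h
        exact absurd (hz.symm.trans h0) hj
      · exact h
    have h1 := hv 0 hzpos
    rw [h0] at h1
    exact (Finset.sum_pos' (fun k _ => hs i k) ⟨_, Finset.mem_univ _, h1⟩).ne'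
  have hreach : ∀ i j, ∃ c, PhaseReach w θ i j c := by
    intro i j
    by_cases hij : i = j
    · subst hij
      exact ⟨1, PhaseReach.refl i⟩
    · obtain ⟨z, v, hv, h0, hz⟩ := hconn i j hij
      have := PhaseReach.of_walk w θ z v hv
      rw [h0, hz] at this
      exact ⟨_, this⟩
  constructor
  · rintro ⟨x, hx0, hx⟩
    rw [eigen_iff w θ hd] at hx
    have : Nonempty (Fin n) := ⟨⟨0, by omega⟩⟩
    obtain ⟨r, hr⟩ := Finite.exists_max (fun i => ‖x i‖)
    have hstep : ∀ i j, ‖x i‖ = ‖x r‖ → 0 < symWeight w i j →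
        x i = -(edgePhase w θ i j * x j) := by
      intro i j hi hij
      refine eq_neg_of_max (symWeight w i) (hs i) (x i) (fun j => edgePhase w θ i j * x j)
        ?_ (hx i) j hij
      intro k
      rw [norm_mul, edgePhase_norm, one_mul, hi]
      exact hr k
    have hprop : ∀ i j c, PhaseReach w θ i j c → ‖x i‖ = ‖x r‖ →
        ‖x j‖ = ‖x r‖ ∧ x i = c * x j := by
      intro i j c h
      induction h with
      | refl i => intro h; exact ⟨h, by simp⟩
      | cons i l j c hl t ih =>
        intro hi
        have h1 := hstep i l hi hl
        have h2 : ‖x l‖ = ‖x r‖ := by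
          rw [← hi, h1, norm_neg, norm_mul, edgePhase_norm, one_mul]
        obtain ⟨h3, h4⟩ := ih h2
        refine ⟨h3, ?_⟩
        rw [h1, h4]; ring
    have hne : x r ≠ 0 := by
      intro h
      apply hx0
      funext i
      have := hr i
      simp only [h, norm_zero] at this
      exact norm_le_zero_iff.1 this
    intro z v hv hz
    rw [← walkPhase_eq_one]
    obtain ⟨c, hc⟩ := hreach r (v 0)
    have hn0 := (hprop _ _ _ hc rfl).1
    have hw1 := PhaseReach.of_walk w θ z v hv
    rw [hz] at hw1
    have h2 := (hprop _ _ _ hw1 hn0).2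
    have hv0 : x (v 0) ≠ 0 := by
      rw [← norm_ne_zero_iff, hn0, norm_ne_zero_iff]
      exact hne
    exact (mul_eq_right₀ hv0).1 h2.symm
  · intro h
    have hclosed : ∀ i c, PhaseReach w θ i i c → c = 1 := by
      intro i c hc
      obtain ⟨z, v, hv, h0, hz, hp⟩ := hc.to_walk
      rw [← hp, walkPhase_eq_one]
      exact h z v hv (hz.trans h0.symm)
    let r : Fin n := ⟨0, by omega⟩
    choose x hx using fun i => hreach i r
    refine ⟨x, ?_, ?_⟩
    · intro h0
      have := hclosed r (x r) (hx r)
      rw [h0] at this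
      simp at this
    · rw [eigen_iff w θ hd]
      intro i
      refine Finset.sum_eq_zero fun j _ => ?_
      rcases (hs i j).eq_or_lt with h0 | h0
      · rw [← h0]; simp
      · obtain ⟨d, hd1, hd2⟩ := (hx i).symm
        have h3 := hclosed _ _ ((PhaseReach.cons i j r _ h0 (hx j)).trans hd2)
        have : x i + edgePhase w θ i j * x j = 0 := by
          linear_combination (edgePhase w θ i j * x j) * (-hd1) - x i * h3
        rw [this, mul_zero]
end
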